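/- Let m ≥ 1 be an integer and α > 0. Suppose h : ℝ × [0,∞) → ℝ is a smooth global-in-time solution of the length-preserving (LP) support-function flow, 2mπ-periodic in θ, with h + h_θθ > 0 everywhere. Then the initial data satisfy L(0)² ≥ 4mπ·A(0), where L(0) = ∫₀^{2mπ} h(θ,0) dθ and A(0) = (1/2)∫₀^{2mπ} h(θ,0)(h(θ,0)+h_θθ(θ,0)) dθ. Equivalently: if the initial locally convex closed curve satisfies L₀² < 4mπ A₀, then a singularity appears at some finite time during the evolution of the LP flow. -/

import Mathlib

open Real MeasureTheory Filter

/-- Second derivative of the support function in the angle variable. -/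
noncomputable def hpp (h : ℝ → ℝ → ℝ) (θ t : ℝ) : ℝ :=
  iteratedDeriv 2 (fun x => h x t) θ

/-- Length of the evolving curve: `L(t) = ∫₀^{2mπ} h dθ`. -/
noncomputable def len (m : ℕ) (h : ℝ → ℝ → ℝ) (t : ℝ) : ℝ :=
  ∫ θ in (0:ℝ)..(2 * m * π), h θ t

/-- Algebraic area: `A(t) = (1/2)∫₀^{2mπ} h (h + h_θθ) dθ`. -/
noncomputable def area (m : ℕ) (h : ℝ → ℝ → ℝ) (t : ℝ) : ℝ :=
  (1 / 2) * ∫ θ in (0:ℝ)..(2 * m * π), h θ t * (h θ t + hpp h θ t)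

/-- Nonlocal term of the length-preserving support-function flow:
`λ(t) = (1/(2mπ)) ∫₀^{2mπ} (h + h_θθ)^{-α} dθ`. -/
noncomputable def lamLP (m : ℕ) (α : ℝ) (h : ℝ → ℝ → ℝ) (t : ℝ) : ℝ :=
  (1 / (2 * m * π)) * ∫ θ in (0:ℝ)..(2 * m * π), (h θ t + hpp h θ t) ^ (-α)


/-- Integrals of `u = f + f''` over a period: `∫ u = ∫ f`, `∫ u cos = ∫ u sin = 0`. -/
lemma aux_ints (P : ℝ) (hc : cos P = 1) (hs : sin P = 0) (f f1 f2 : ℝ → ℝ)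
    (h1 : ∀ x, HasDerivAt f (f1 x) x) (h2 : ∀ x, HasDerivAt f1 (f2 x) x)
    (c2 : Continuous f2) (p0 : f P = f 0) (p1 : f1 P = f1 0) :
    (∫ x in (0:ℝ)..P, (f x + f2 x)) = (∫ x in (0:ℝ)..P, f x) ∧
    (∫ x in (0:ℝ)..P, (f x + f2 x) * cos x) = 0 ∧
    (∫ x in (0:ℝ)..P, (f x + f2 x) * sin x) = 0 := by
  have c0 : Continuous f := continuous_iff_continuousAt.2 fun x => (h1 x).continuousAt
  have c1 : Continuous f1 := continuous_iff_continuousAt.2 fun x => (h2 x).continuousAt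
  refine ⟨?_, ?_, ?_⟩
  · rw [intervalIntegral.integral_add (c0.intervalIntegrable _ _) (c2.intervalIntegrable _ _),
      intervalIntegral.integral_eq_sub_of_hasDerivAt (fun x _ => h2 x) (c2.intervalIntegrable _ _),
      p1]
    ring
  · rw [intervalIntegral.integral_eq_sub_of_hasDerivAt
      (f := fun x => f1 x * cos x + f x * sin x) (fun x _ => ?_)
      (Continuous.intervalIntegrable (by fun_prop) _ _)]
    · simp [hc, hs, p1]
    · have := ((h2 x).mul (hasDerivAt_cos x)).add ((h1 x).mul (hasDerivAt_sin x))
      refine this.congr_deriv ?_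
      ring
  · rw [intervalIntegral.integral_eq_sub_of_hasDerivAt
      (f := fun x => f1 x * sin x - f x * cos x) (fun x _ => ?_)
      (Continuous.intervalIntegrable (by fun_prop) _ _)]
    · simp [hc, hs, p0]
    · have := ((h2 x).mul (hasDerivAt_sin x)).sub ((h1 x).mul (hasDerivAt_cos x))
      refine this.congr_deriv ?_
      ring

lemma aux_sup (P : ℝ) (f f1 f2 : ℝ → ℝ)
    (h1 : ∀ x, HasDerivAt f (f1 x) x) (h2 : ∀ x, HasDerivAt f1 (f2 x) x)
    (c2 : Continuous f2) (pos : ∀ x, 0 < f x + f2 x) (x : ℝ) (hx : x ∈ Set.Icc 0 P) :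
    |f x - f 0 * cos x - f1 0 * sin x| ≤ ∫ x in (0:ℝ)..P, (f x + f2 x) := by
  have c0 : Continuous f := continuous_iff_continuousAt.2 fun x => (h1 x).continuousAt
  have key : (∫ s in (0:ℝ)..x, (f s + f2 s) * sin (x - s)) = f x - f 0 * cos x - f1 0 * sin x := by
    rw [intervalIntegral.integral_eq_sub_of_hasDerivAt
      (f := fun s => f1 s * sin (x - s) + f s * cos (x - s)) (fun s _ => ?_)
      (Continuous.intervalIntegrable (by fun_prop) _ _)]
    · simp; ring
    · have hd : HasDerivAt (fun s => x - s) (-1) s := by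
        simpa using (hasDerivAt_id s).const_sub x
      have := ((h2 s).mul ((hasDerivAt_sin (x - s)).comp s hd)).add
        ((h1 s).mul ((hasDerivAt_cos (x - s)).comp s hd))
      refine this.congr_deriv ?_
      simp only [Function.comp_apply]
      ring
  rw [← key]
  calc |∫ s in (0:ℝ)..x, (f s + f2 s) * sin (x - s)|
      ≤ ∫ s in (0:ℝ)..x, |(f s + f2 s) * sin (x - s)| :=
        intervalIntegral.abs_integral_le_integral_abs hx.1
    _ ≤ ∫ s in (0:ℝ)..x, (f s + f2 s) := by
        apply intervalIntegral.integral_mono_on hx.1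
          (Continuous.intervalIntegrable (by fun_prop) _ _)
          (Continuous.intervalIntegrable (by fun_prop) _ _)
        intro s _
        rw [abs_mul, abs_of_pos (pos s)]
        exact mul_le_of_le_one_right (pos s).le (abs_sin_le_one _)
    _ ≤ _ := by
        apply intervalIntegral.integral_mono_interval le_rfl hx.1 hx.2
        · exact Filter.Eventually.of_forall fun s => (pos s).le
        · exact Continuous.intervalIntegrable (by fun_prop) _ _

/-- Deficit bound: `∫ f u - ū L ≤ L ∫ |u - ū|`. -/
lemma aux_def (P : ℝ) (hP : 0 < P) (hc : cos P = 1) (hs : sin P = 0) (f f1 f2 : ℝ → ℝ)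
    (h1 : ∀ x, HasDerivAt f (f1 x) x) (h2 : ∀ x, HasDerivAt f1 (f2 x) x)
    (c2 : Continuous f2) (p0 : f P = f 0) (p1 : f1 P = f1 0)
    (pos : ∀ x, 0 < f x + f2 x) (L : ℝ) (hL : L = ∫ x in (0:ℝ)..P, f x) :
    (∫ x in (0:ℝ)..P, f x * (f x + f2 x)) - L / P * L
      ≤ L * ∫ x in (0:ℝ)..P, |f x + f2 x - L / P| := by
  obtain ⟨i1, i2, i3⟩ := aux_ints P hc hs f f1 f2 h1 h2 c2 p0 p1
  have c0 : Continuous f := continuous_iff_continuousAt.2 fun x => (h1 x).continuousAt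
  have e : (∫ x in (0:ℝ)..P, (f x - f 0 * cos x - f1 0 * sin x) * (f x + f2 x - L / P))
      = (∫ x in (0:ℝ)..P, f x * (f x + f2 x)) - L / P * L := by
    have : ∀ x, (f x - f 0 * cos x - f1 0 * sin x) * (f x + f2 x - L / P)
        = f x * (f x + f2 x) - L / P * f x - f 0 * ((f x + f2 x) * cos x)
          - f1 0 * ((f x + f2 x) * sin x) + (L / P * f 0) * cos x + (L / P * f1 0) * sin x := by
      intro x; ring
    simp_rw [this]
    rw [intervalIntegral.integral_add, intervalIntegral.integral_add,
      intervalIntegral.integral_sub, intervalIntegral.integral_sub, intervalIntegral.integral_sub]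
    · simp only [intervalIntegral.integral_const_mul]
      rw [i2, i3, ← hL]
      simp [hc, hs]
    all_goals exact Continuous.intervalIntegrable (by fun_prop) _ _
  rw [← e, ← intervalIntegral.integral_const_mul]
  apply intervalIntegral.integral_mono_on hP.le
    (Continuous.intervalIntegrable (by fun_prop) _ _)
    (Continuous.intervalIntegrable (by fun_prop) _ _)
  intro x hx
  have := aux_sup P f f1 f2 h1 h2 c2 pos x hx
  rw [i1, ← hL] at this
  refine (le_abs_self _).trans ?_
  rw [abs_mul]
  gcongr

/-- Dissipation identity and estimates. -/
lemma aux_diss (P : ℝ) (hP : 0 < P) (α : ℝ) (hα : 0 < α) (u : ℝ → ℝ) (cu : Continuous u)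
    (pos : ∀ x, 0 < u x) (L : ℝ) (hL : L = ∫ x in (0:ℝ)..P, u x) (ε : ℝ) (hε : 0 < ε) (D : ℝ)
    (hD : D = ∫ x in (0:ℝ)..P, (-(u x) ^ (-α) + (1 / P) * ∫ y in (0:ℝ)..P, (u y) ^ (-α)) * u x) :
    0 ≤ D ∧ ((L / P) ^ (-α) - (L / P + ε) ^ (-α)) * (∫ x in (0:ℝ)..P, |u x - L / P|)
      ≤ 2 * (P * ε * ((L / P) ^ (-α) - (L / P + ε) ^ (-α)) + D) := by
  have hLpos : 0 < L := by
    rw [hL]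
    exact intervalIntegral.intervalIntegral_pos_of_pos (cu.intervalIntegrable _ _) pos hP
  set a := L / P with ha
  have hapos : 0 < a := by positivity
  have haP : a * P = L := by rw [ha]; field_simp
  have cp : Continuous fun x => (u x) ^ (-α) :=
    cu.rpow_const fun x => Or.inl (pos x).ne'
  have mono : ∀ x y : ℝ, 0 < x → x ≤ y → y ^ (-α) ≤ x ^ (-α) := fun x y hx hxy =>
    Real.rpow_le_rpow_of_nonpos hx hxy (by linarith)
  have hk : 0 < a ^ (-α) - (a + ε) ^ (-α) := by
    have := Real.rpow_lt_rpow_of_neg hapos (by linarith : a < a + ε) (by linarith : -α < 0)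
    linarith
  set k := a ^ (-α) - (a + ε) ^ (-α) with hkdef
  have hD2 : D = ∫ x in (0:ℝ)..P, (u x - a) * (a ^ (-α) - (u x) ^ (-α)) := by
    rw [hD]
    set M := ∫ y in (0:ℝ)..P, (u y) ^ (-α) with hM
    have e1 : ∀ x, (-(u x) ^ (-α) + 1 / P * M) * u x
        = (1 / P * M) * u x - (u x) ^ (-α) * u x := by intro x; ring
    have e2 : ∀ x, (u x - a) * (a ^ (-α) - (u x) ^ (-α))
        = a ^ (-α) * u x + a * (u x) ^ (-α) - (u x) ^ (-α) * u x - a * a ^ (-α) := by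
      intro x; ring
    simp_rw [e1, e2]
    rw [intervalIntegral.integral_sub, intervalIntegral.integral_sub,
      intervalIntegral.integral_sub, intervalIntegral.integral_add]
    · simp only [intervalIntegral.integral_const_mul, intervalIntegral.integral_const]
      rw [← hL, ← hM, ← haP]
      simp only [smul_eq_mul]
      field_simp
      ring
    all_goals exact Continuous.intervalIntegrable (by fun_prop) _ _
  have nn : ∀ x, 0 ≤ (u x - a) * (a ^ (-α) - (u x) ^ (-α)) := by
    intro x
    rcases le_total a (u x) with h | h
    · exact mul_nonneg (by linarith) (by linarith [mono a (u x) hapos h])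
    · exact mul_nonneg_of_nonpos_of_nonpos (by linarith) (by linarith [mono (u x) a (pos x) h])
  refine ⟨?_, ?_⟩
  · rw [hD2]
    exact intervalIntegral.integral_nonneg hP.le fun x _ => nn x
  · have pt : ∀ x, k * |u x - a| ≤
        2 * (ε * k + (u x - a) * (a ^ (-α) - (u x) ^ (-α))) - k * (u x - a) := by
      intro x
      have hn := nn x
      rcases le_total (u x) a with h | h
      · rw [abs_of_nonpos (by linarith)]
        nlinarith [mul_pos hε hk]
      · rw [abs_of_nonneg (by linarith)]
        rcases le_total (u x) (a + ε) with h' | h'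
        · nlinarith
        · have := mono (a + ε) (u x) (by linarith) h'
          have : (u x - a) * k ≤ (u x - a) * (a ^ (-α) - (u x) ^ (-α)) :=
            mul_le_mul_of_nonneg_left (by linarith) (by linarith)
          nlinarith [mul_pos hε hk]
    rw [← intervalIntegral.integral_const_mul]
    calc _ ≤ ∫ x in (0:ℝ)..P,
          (2 * (ε * k + (u x - a) * (a ^ (-α) - (u x) ^ (-α))) - k * (u x - a)) := by
          apply intervalIntegral.integral_mono_on hP.le
            (Continuous.intervalIntegrable (by fun_prop) _ _)
            (Continuous.intervalIntegrable (by fun_prop) _ _)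
          intro x _
          exact pt x
      _ = _ := by
        rw [intervalIntegral.integral_sub (Continuous.intervalIntegrable (by fun_prop) _ _)
          (Continuous.intervalIntegrable (by fun_prop) _ _),
          intervalIntegral.integral_const_mul, intervalIntegral.integral_const_mul,
          intervalIntegral.integral_add (Continuous.intervalIntegrable (by fun_prop) _ _)
          (Continuous.intervalIntegrable (by fun_prop) _ _), ← hD2,
          intervalIntegral.integral_sub (Continuous.intervalIntegrable (by fun_prop) _ _)
          (Continuous.intervalIntegrable (by fun_prop) _ _), ← hL]
        simp only [intervalIntegral.integral_const, smul_eq_mul]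
        rw [← haP]
        ring

/-- Symmetry of `∫ f (g + g'')` on periodic functions. -/
lemma aux_symm (P : ℝ) (f f1 f2 g g1 g2 : ℝ → ℝ)
    (h1 : ∀ x, HasDerivAt f (f1 x) x) (h2 : ∀ x, HasDerivAt f1 (f2 x) x)
    (c2 : Continuous f2) (p0 : f P = f 0) (p1 : f1 P = f1 0)
    (k1 : ∀ x, HasDerivAt g (g1 x) x) (k2 : ∀ x, HasDerivAt g1 (g2 x) x)
    (d2 : Continuous g2) (q0 : g P = g 0) (q1 : g1 P = g1 0) :
    (∫ x in (0:ℝ)..P, f x * (f x + f2 x)) - (∫ x in (0:ℝ)..P, g x * (g x + g2 x))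
      = ∫ x in (0:ℝ)..P, (f x - g x) * ((f x + f2 x) + (g x + g2 x)) := by
  have c0 : Continuous f := continuous_iff_continuousAt.2 fun x => (h1 x).continuousAt
  have d0 : Continuous g := continuous_iff_continuousAt.2 fun x => (k1 x).continuousAt
  have e : (∫ x in (0:ℝ)..P, (f x * g2 x - g x * f2 x)) = 0 := by
    rw [intervalIntegral.integral_eq_sub_of_hasDerivAt
      (f := fun x => f x * g1 x - g x * f1 x) (fun x _ => ?_)
      (Continuous.intervalIntegrable (by fun_prop) _ _)]
    · simp [p0, p1, q0, q1]
    · have := ((h1 x).mul (k2 x)).sub ((k1 x).mul (h2 x))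
      refine this.congr_deriv ?_
      ring
  have e2 : ∀ x, (f x - g x) * ((f x + f2 x) + (g x + g2 x))
      = f x * (f x + f2 x) - g x * (g x + g2 x) + (f x * g2 x - g x * f2 x) := by
    intro x; ring
  simp_rw [e2]
  rw [intervalIntegral.integral_add, intervalIntegral.integral_sub, e, add_zero]
  all_goals exact Continuous.intervalIntegrable (by fun_prop) _ _

/-- Partial derivatives of a function smooth on `ℝ × [0,∞)`. -/
lemma aux_partial (H : ℝ × ℝ → ℝ)
    (hH : ContDiffOn ℝ (⊤ : ℕ∞) H (Set.univ ×ˢ Set.Ici (0:ℝ))) (v : ℝ × ℝ) :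
    ContDiffOn ℝ (⊤ : ℕ∞) (fun p => fderivWithin ℝ H (Set.univ ×ˢ Set.Ici (0:ℝ)) p v)
      (Set.univ ×ˢ Set.Ici (0:ℝ)) := by
  have hu : UniqueDiffOn ℝ ((Set.univ : Set ℝ) ×ˢ Set.Ici (0:ℝ)) :=
    uniqueDiffOn_univ.prod (uniqueDiffOn_Ici 0)
  exact (hH.fderivWithin hu (by simp)).clm_apply contDiffOn_const

lemma aux_theta (H : ℝ × ℝ → ℝ)
    (hH : ContDiffOn ℝ (⊤ : ℕ∞) H (Set.univ ×ˢ Set.Ici (0:ℝ))) (x t : ℝ) (ht : 0 ≤ t) :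
    HasDerivAt (fun x => H (x, t))
      (fderivWithin ℝ H (Set.univ ×ˢ Set.Ici (0:ℝ)) (x, t) (1, 0)) x := by
  have hd := (hH.differentiableOn (by simp) (x, t) ⟨trivial, ht⟩).hasFDerivWithinAt
  have hc : HasDerivWithinAt (fun x : ℝ => (x, t)) ((1:ℝ), (0:ℝ)) Set.univ x :=
    ((hasDerivAt_id x).prodMk (hasDerivAt_const x t)).hasDerivWithinAt
  exact hasDerivWithinAt_univ.1 (hd.comp_hasDerivWithinAt x hc (fun y _ => Set.mk_mem_prod trivial ht))

lemma aux_time (H : ℝ × ℝ → ℝ)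
    (hH : ContDiffOn ℝ (⊤ : ℕ∞) H (Set.univ ×ˢ Set.Ici (0:ℝ))) (x t : ℝ) (ht : 0 ≤ t) :
    HasDerivWithinAt (fun s => H (x, s))
      (fderivWithin ℝ H (Set.univ ×ˢ Set.Ici (0:ℝ)) (x, t) (0, 1)) (Set.Ici 0) t := by
  have hd := (hH.differentiableOn (by simp) (x, t) ⟨trivial, ht⟩).hasFDerivWithinAt
  have hc : HasDerivWithinAt (fun s : ℝ => (x, s)) ((0:ℝ), (1:ℝ)) (Set.Ici 0) t :=
    ((hasDerivAt_const t x).prodMk (hasDerivAt_id t)).hasDerivWithinAt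
  exact hd.comp_hasDerivWithinAt t hc (fun y hy => ⟨trivial, hy⟩)

lemma aux_slice (H : ℝ × ℝ → ℝ)
    (hH : ContinuousOn H (Set.univ ×ˢ Set.Ici (0:ℝ))) (t : ℝ) (ht : 0 ≤ t) :
    Continuous (fun x => H (x, t)) := by
  exact hH.comp_continuous (by fun_prop) fun x => ⟨trivial, ht⟩

/-- Limit of integrated difference quotients. -/
lemma aux_dct (P : ℝ) (hP : 0 < P) (H Ht W : ℝ × ℝ → ℝ)
    (cH : ContinuousOn H (Set.univ ×ˢ Set.Ici (0:ℝ)))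
    (cHt : ContinuousOn Ht (Set.univ ×ˢ Set.Ici (0:ℝ)))
    (cW : ContinuousOn W (Set.univ ×ˢ Set.Ici (0:ℝ)))
    (hd : ∀ x t, 0 ≤ t → HasDerivWithinAt (fun s => H (x, s)) (Ht (x, t)) (Set.Ici 0) t)
    (t : ℝ) (ht : 0 ≤ t) :
    Tendsto (fun s => ∫ x in (0:ℝ)..P, ((s - t)⁻¹ * (H (x, s) - H (x, t))) * W (x, s))
      (nhdsWithin t (Set.Ici 0 \ {t})) (nhds (∫ x in (0:ℝ)..P, Ht (x, t) * W (x, t))) := by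
  have hsub : Set.Icc 0 P ×ˢ Set.Icc 0 (t + 1) ⊆ (Set.univ : Set ℝ) ×ˢ Set.Ici (0:ℝ) :=
    fun p hp => ⟨trivial, hp.2.1⟩
  have hK : IsCompact (Set.Icc 0 P ×ˢ Set.Icc 0 (t + 1)) := isCompact_Icc.prod isCompact_Icc
  obtain ⟨C1, hC1⟩ := hK.exists_bound_of_continuousOn (cHt.mono hsub)
  obtain ⟨C2, hC2⟩ := hK.exists_bound_of_continuousOn (cW.mono hsub)
  have hev : ∀ᶠ s in nhdsWithin t (Set.Ici 0 \ {t}), s ∈ Set.Icc 0 (t + 1) ∧ s ≠ t := by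
    have h1 : ∀ᶠ s in nhdsWithin t (Set.Ici 0 \ {t}), s < t + 1 :=
      mem_nhdsWithin_of_mem_nhds (Iio_mem_nhds (by linarith))
    filter_upwards [h1, self_mem_nhdsWithin] with s hs hs'
    exact ⟨⟨hs'.1, hs.le⟩, hs'.2⟩
  apply intervalIntegral.tendsto_integral_filter_of_dominated_convergence (fun _ => C1 * C2)
  · filter_upwards [hev] with s hs
    have a1 := aux_slice H cH s hs.1.1
    have a2 := aux_slice H cH t ht
    have a3 := aux_slice W cW s hs.1.1
    exact ((continuous_const.mul (a1.sub a2)).mul a3).aestronglyMeasurable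
  · filter_upwards [hev] with s hs
    refine Filter.Eventually.of_forall fun x hx => ?_
    rw [Set.uIoc_of_le hP.le] at hx
    have hx' : x ∈ Set.Icc 0 P := ⟨hx.1.le, hx.2⟩
    have hC1n : 0 ≤ C1 := (norm_nonneg _).trans (hC1 (x, t) ⟨hx', ht, by simp⟩)
    rw [norm_mul]
    refine mul_le_mul ?_ (hC2 (x, s) ⟨hx', hs.1⟩) (norm_nonneg _) hC1n
    have mv := (convex_Icc (0:ℝ) (t + 1)).norm_image_sub_le_of_norm_hasDerivWithin_le
      (f := fun s => H (x, s)) (f' := fun s => Ht (x, s)) (C := C1)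
      (fun r hr => (hd x r hr.1).mono Set.Icc_subset_Ici_self)
      (fun r hr => hC1 (x, r) ⟨hx', hr⟩) (x := t) (y := s) ⟨ht, by simp⟩ hs.1
    rw [norm_mul, norm_inv, inv_mul_le_iff₀ (norm_pos_iff.2 (sub_ne_zero.2 hs.2))]
    linarith
  · exact intervalIntegrable_const
  · refine Filter.Eventually.of_forall fun x _ => ?_
    refine Tendsto.mul ?_ ?_
    · have := hasDerivWithinAt_iff_tendsto_slope.1 (hd x t ht)
      exact this
    · have h1 : ContinuousWithinAt (fun s => W (x, s)) (Set.Ici 0) t :=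
        (cW (x, t) ⟨trivial, ht⟩).comp (t := Set.univ ×ˢ Set.Ici (0:ℝ))
          (f := fun s : ℝ => (x, s)) (by fun_prop) (fun y hy => ⟨trivial, hy⟩)
      exact h1.mono_left (nhdsWithin_mono _ Set.sdiff_subset)

/-- If the LP support-function flow has a smooth global-in-time solution, then the
initial data satisfy `L(0)² ≥ 4mπ A(0)`.  Equivalently, if `L₀² < 4mπ A₀` a singularity
appears at some finite time. -/
theorem lp_global_implies_isoperimetric
    (m : ℕ) (hm : 1 ≤ m) (α : ℝ) (hα : 0 < α) (h : ℝ → ℝ → ℝ)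
    (hsmooth : ContDiffOn ℝ (⊤ : ℕ∞) (Function.uncurry h) (Set.univ ×ˢ Set.Ici (0:ℝ)))
    (hper : ∀ θ t, 0 ≤ t → h (θ + 2 * m * π) t = h θ t)
    (hconv : ∀ θ t, 0 ≤ t → 0 < h θ t + hpp h θ t)
    (hflow : ∀ θ t, 0 ≤ t →
      derivWithin (fun s => h θ s) (Set.Ici 0) t
        = -(h θ t + hpp h θ t) ^ (-α) + lamLP m α h t) :
    4 * m * π * area m h 0 ≤ (len m h 0) ^ 2 := by
  set P : ℝ := 2 * m * π with hPdef
  have hm' : (1:ℝ) ≤ m := by exact_mod_cast hm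
  have hP : 0 < P := by have := Real.pi_pos; positivity
  have hcP : cos P = 1 := by
    have := Real.cos_nat_mul_two_pi m
    rw [← this]; congr 1; rw [hPdef]; ring
  have hsP : sin P = 0 := by
    have := Real.sin_nat_mul_pi (2 * m)
    rw [← this]; congr 1; rw [hPdef]; push_cast; ring
  set H : ℝ × ℝ → ℝ := Function.uncurry h with hHdef
  set H1 : ℝ × ℝ → ℝ := fun p => fderivWithin ℝ H (Set.univ ×ˢ Set.Ici (0:ℝ)) p (1, 0) with hH1
  set H2 : ℝ × ℝ → ℝ := fun p => fderivWithin ℝ H1 (Set.univ ×ˢ Set.Ici (0:ℝ)) p (1, 0) with hH2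
  set Ht : ℝ × ℝ → ℝ := fun p => fderivWithin ℝ H (Set.univ ×ˢ Set.Ici (0:ℝ)) p (0, 1) with hHt
  have s1 : ContDiffOn ℝ (⊤ : ℕ∞) H1 (Set.univ ×ˢ Set.Ici (0:ℝ)) := aux_partial H hsmooth _
  have s2 : ContDiffOn ℝ (⊤ : ℕ∞) H2 (Set.univ ×ˢ Set.Ici (0:ℝ)) := aux_partial H1 s1 _
  have st : ContDiffOn ℝ (⊤ : ℕ∞) Ht (Set.univ ×ˢ Set.Ici (0:ℝ)) := aux_partial H hsmooth _
  have d1 : ∀ t, 0 ≤ t → ∀ x, HasDerivAt (fun x => h x t) (H1 (x, t)) x :=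
    fun t ht x => aux_theta H hsmooth x t ht
  have d2 : ∀ t, 0 ≤ t → ∀ x, HasDerivAt (fun x => H1 (x, t)) (H2 (x, t)) x :=
    fun t ht x => aux_theta H1 s1 x t ht
  have dt : ∀ x t, 0 ≤ t → HasDerivWithinAt (fun s => H (x, s)) (Ht (x, t)) (Set.Ici 0) t :=
    fun x t ht => aux_time H hsmooth x t ht
  have hpp_eq : ∀ x t, 0 ≤ t → hpp h x t = H2 (x, t) := by
    intro x t ht
    unfold hpp
    rw [iteratedDeriv_succ, iteratedDeriv_one]
    have : deriv (fun x => h x t) = fun x => H1 (x, t) := funext fun y => (d1 t ht y).deriv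
    rw [this]
    exact (d2 t ht x).deriv
  have c2 : ∀ t, 0 ≤ t → Continuous fun x => H2 (x, t) :=
    fun t ht => aux_slice H2 s2.continuousOn t ht
  have c0 : ∀ t, 0 ≤ t → Continuous fun x => h x t :=
    fun t ht => aux_slice H hsmooth.continuousOn t ht
  have p0 : ∀ t, 0 ≤ t → h P t = h 0 t := by
    intro t ht
    have := hper 0 t ht
    rwa [zero_add] at this
  have p1 : ∀ t, 0 ≤ t → H1 (P, t) = H1 (0, t) := by
    intro t ht
    have e1 : HasDerivAt (fun x => h (x + P) t) (H1 (P, t)) 0 := by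
      have := d1 t ht (0 + P)
      have := HasDerivAt.comp_add_const 0 P this
      rwa [zero_add] at this
    have e2 : (fun x => h (x + P) t) = fun x => h x t := funext fun x => hper x t ht
    rw [e2] at e1
    exact e1.unique (d1 t ht 0)
  have pos : ∀ t, 0 ≤ t → ∀ x, 0 < h x t + H2 (x, t) := by
    intro t ht x
    rw [← hpp_eq x t ht]
    exact hconv x t ht
  have flow : ∀ t, 0 ≤ t → ∀ x, Ht (x, t) = -(h x t + H2 (x, t)) ^ (-α)
      + (1 / P) * ∫ y in (0:ℝ)..P, (h y t + H2 (y, t)) ^ (-α) := by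
    intro t ht x
    have e1 : derivWithin (fun s => h x s) (Set.Ici 0) t = Ht (x, t) :=
      (dt x t ht).derivWithin (uniqueDiffOn_Ici 0 t ht)
    rw [← e1, hflow x t ht]
    unfold lamLP
    simp only [hpp_eq _ t ht]
    rfl
  have hlen : ∀ t, 0 ≤ t → len m h t = len m h 0 := by
    have hder : ∀ t, 0 ≤ t → HasDerivWithinAt (len m h) 0 (Set.Ici 0) t := by
      intro t ht
      rw [hasDerivWithinAt_iff_tendsto_slope]
      have key := aux_dct P hP H Ht (fun _ => 1) hsmooth.continuousOn st.continuousOn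
        continuousOn_const dt t ht
      have z : (∫ x in (0:ℝ)..P, Ht (x, t) * 1) = 0 := by
        simp only [mul_one, flow t ht]
        have cp : Continuous fun x => (h x t + H2 (x, t)) ^ (-α) :=
          ((c0 t ht).add (c2 t ht)).rpow_const fun x => Or.inl (pos t ht x).ne'
        have cpn : Continuous fun x => -(h x t + H2 (x, t)) ^ (-α) := cp.neg
        rw [intervalIntegral.integral_add (cpn.intervalIntegrable _ _)
          intervalIntegrable_const, intervalIntegral.integral_neg,
          intervalIntegral.integral_const, smul_eq_mul]
        field_simp
        ring
      rw [z] at key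
      refine key.congr' ?_
      filter_upwards [self_mem_nhdsWithin] with s hs
      simp only [mul_one, intervalIntegral.integral_const_mul]
      rw [slope_def_field, div_eq_inv_mul]
      unfold len
      rw [← intervalIntegral.integral_sub ((c0 s hs.1).intervalIntegrable _ _)
        ((c0 t ht).intervalIntegrable _ _)]
      rfl
    intro t ht
    refine constant_of_has_deriv_right_zero (a := 0) (b := t) ?_ ?_ t ⟨ht, le_rfl⟩
    · intro s hs
      exact (hder s hs.1).continuousWithinAt.mono Set.Icc_subset_Ici_self
    · intro s hs
      exact (hder s hs.1).mono (Set.Ici_subset_Ici.2 hs.1)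
  set L := len m h 0 with hL
  have hLh : ∀ t, 0 ≤ t → L = ∫ x in (0:ℝ)..P, h x t := fun t ht => (hlen t ht).symm
  have hLu : ∀ t, 0 ≤ t → L = ∫ x in (0:ℝ)..P, (h x t + H2 (x, t)) := by
    intro t ht
    rw [hLh t ht]
    exact (aux_ints P hcP hsP _ _ _ (d1 t ht) (d2 t ht) (c2 t ht) (p0 t ht) (p1 t ht)).1.symm
  have hLpos : 0 < L := by
    rw [hLu 0 le_rfl]
    exact intervalIntegral.intervalIntegral_pos_of_pos
      (((c0 0 le_rfl).add (c2 0 le_rfl)).intervalIntegrable _ _) (pos 0 le_rfl) hP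
  have harea : ∀ t, 0 ≤ t → area m h t = 1 / 2 * ∫ x in (0:ℝ)..P, h x t * (h x t + H2 (x, t)) := by
    intro t ht
    unfold area
    simp only [hpp_eq _ t ht]
    rfl
  set D : ℝ → ℝ := fun t => ∫ x in (0:ℝ)..P, Ht (x, t) * (h x t + H2 (x, t)) with hD
  have hDflow : ∀ t, 0 ≤ t → D t = ∫ x in (0:ℝ)..P, (-(h x t + H2 (x, t)) ^ (-α)
      + (1 / P) * ∫ y in (0:ℝ)..P, (h y t + H2 (y, t)) ^ (-α)) * (h x t + H2 (x, t)) := by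
    intro t ht
    simp only [hD, flow t ht]
  have hAder : ∀ t, 0 ≤ t → HasDerivWithinAt (area m h) (D t) (Set.Ici 0) t := by
    intro t ht
    rw [hasDerivWithinAt_iff_tendsto_slope]
    have cW : ContinuousOn (fun p : ℝ × ℝ =>
        1 / 2 * ((H p + H2 p) + (h p.1 t + H2 (p.1, t)))) (Set.univ ×ˢ Set.Ici (0:ℝ)) := by
      refine continuousOn_const.mul ((hsmooth.continuousOn.add s2.continuousOn).add ?_)
      exact (((c0 t ht).add (c2 t ht)).comp continuous_fst).continuousOn
    have key := aux_dct P hP H Ht _ hsmooth.continuousOn st.continuousOn cW dt t ht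
    have z : (∫ x in (0:ℝ)..P, Ht (x, t) *
        (1 / 2 * ((H (x, t) + H2 (x, t)) + (h x t + H2 (x, t))))) = D t := by
      simp only [hD]
      refine intervalIntegral.integral_congr fun x _ => ?_
      simp only [hHdef, Function.uncurry_apply_pair]
      ring
    simp only at key
    rw [z] at key
    refine key.congr' ?_
    filter_upwards [self_mem_nhdsWithin] with s hs
    have hs0 : 0 ≤ s := hs.1
    have e : area m h s - area m h t = 1 / 2 * ∫ x in (0:ℝ)..P,
        (h x s - h x t) * ((h x s + H2 (x, s)) + (h x t + H2 (x, t))) := by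
      rw [harea s hs0, harea t ht, ← mul_sub,
        aux_symm P _ _ _ _ _ _ (d1 s hs0) (d2 s hs0) (c2 s hs0) (p0 s hs0) (p1 s hs0)
        (d1 t ht) (d2 t ht) (c2 t ht) (p0 t ht) (p1 t ht)]
    rw [slope_def_field, div_eq_inv_mul (area m h s - area m h t), e, ← mul_assoc,
      ← intervalIntegral.integral_const_mul]
    refine intervalIntegral.integral_congr fun x _ => ?_
    simp only [hHdef, Function.uncurry_apply_pair]
    ring
  have grow : ∀ c, (∀ t, 0 ≤ t → c ≤ D t) → ∀ t, 0 ≤ t → c * t ≤ area m h t - area m h 0 := by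
    intro c hc t ht
    have := (convex_Ici (0:ℝ)).mul_sub_le_image_sub_of_le_deriv (f := area m h) (C := c)
      (fun s hs => (hAder s hs).continuousWithinAt)
      (fun s hs => by
        rw [interior_Ici] at hs
        exact ((hAder s (le_of_lt hs)).hasDerivAt (Ici_mem_nhds hs)).differentiableAt.differentiableWithinAt)
      (fun s hs => by
        rw [interior_Ici] at hs
        rw [((hAder s (le_of_lt hs)).hasDerivAt (Ici_mem_nhds hs)).deriv]
        exact hc s (le_of_lt hs))
      0 Set.self_mem_Ici t ht ht
    simpa using this
  have hdef : ∀ t, 0 ≤ t → 2 * area m h t - L / P * L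
      ≤ L * ∫ x in (0:ℝ)..P, |h x t + H2 (x, t) - L / P| := by
    intro t ht
    have := aux_def P hP hcP hsP _ _ _ (d1 t ht) (d2 t ht) (c2 t ht) (p0 t ht) (p1 t ht)
      (pos t ht) L (hLh t ht)
    rw [harea t ht]
    linarith
  have habs : ∀ t, 0 ≤ t → (∫ x in (0:ℝ)..P, |h x t + H2 (x, t) - L / P|) ≤ 2 * L := by
    intro t ht
    have cu : Continuous fun x => h x t + H2 (x, t) := (c0 t ht).add (c2 t ht)
    have cu1 : Continuous fun x => |h x t + H2 (x, t) - L / P| := (cu.sub continuous_const).abs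
    have cu2 : Continuous fun x => h x t + H2 (x, t) + L / P := cu.add continuous_const
    calc _ ≤ ∫ x in (0:ℝ)..P, ((h x t + H2 (x, t)) + L / P) := by
          apply intervalIntegral.integral_mono_on hP.le
            (cu1.intervalIntegrable _ _)
            (cu2.intervalIntegrable _ _)
          intro x _
          have h1 := pos t ht x
          have h2 : 0 < L / P := by positivity
          rw [abs_le]
          constructor <;> linarith
      _ = 2 * L := by
          rw [intervalIntegral.integral_add (cu.intervalIntegrable _ _) intervalIntegrable_const,
            ← hLu t ht, intervalIntegral.integral_const, smul_eq_mul]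
          field_simp
          ring
  have diss := fun (ε : ℝ) (hε : 0 < ε) (t : ℝ) (ht : 0 ≤ t) =>
    aux_diss P hP α hα _ ((c0 t ht).add (c2 t ht)) (pos t ht) L (hLu t ht) ε hε (D t) (hDflow t ht)
  by_contra hcon
  push Not at hcon
  have hδ : 0 < 2 * area m h 0 - L / P * L := by
    have e : L / P * L = L ^ 2 / P := by ring
    rw [e, sub_pos, div_lt_iff₀ hP]
    calc L ^ 2 < _ := hcon
      _ = _ := by rw [hPdef]; ring
  set δ := 2 * area m h 0 - L / P * L with hδdef
  set ε := δ / (4 * L * P) with hε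
  have hεpos : 0 < ε := by positivity
  set k := (L / P) ^ (-α) - (L / P + ε) ^ (-α) with hk
  have hkpos : 0 < k := by
    have hq : 0 < L / P := by positivity
    have := Real.rpow_lt_rpow_of_neg hq (by linarith : L / P < L / P + ε) (by linarith : -α < 0)
    linarith
  have hmono : ∀ t, 0 ≤ t → area m h 0 ≤ area m h t := by
    intro t ht
    have := grow 0 (fun s hs => (diss 1 one_pos s hs).1) t ht
    linarith
  have hc : ∀ t, 0 ≤ t → k * δ / (4 * L) ≤ D t := by
    intro t ht
    have h1 := (diss ε hεpos t ht).2
    have h2 := hdef t ht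
    have h3 := hmono t ht
    have h4 : δ ≤ L * ∫ x in (0:ℝ)..P, |h x t + H2 (x, t) - L / P| := by linarith
    set I := ∫ x in (0:ℝ)..P, |h x t + H2 (x, t) - L / P| with hI
    have h5 : k * I ≤ 2 * (P * ε * k + D t) := h1
    have h6 : P * ε = δ / (4 * L) := by rw [hε]; field_simp
    have h7 : δ / L ≤ I := by rw [div_le_iff₀ hLpos]; linarith
    have h8 : k * (δ / L) ≤ k * I := mul_le_mul_of_nonneg_left h7 hkpos.le
    rw [h6] at h5
    have h9 : k * (δ / L) = 4 * (k * δ / (4 * L)) := by field_simp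
    have h10 : δ / (4 * L) * k = k * δ / (4 * L) := by ring
    rw [h10] at h5
    linarith
  set c := k * δ / (4 * L) with hcdef
  have hcpos : 0 < c := by positivity
  have fin : ∀ t, 0 ≤ t → c * t ≤ L ^ 2 := by
    intro t ht
    have h1 := grow c hc t ht
    have h2 := hdef t ht
    have h3 := mul_le_mul_of_nonneg_left (habs t ht) hLpos.le
    nlinarith
  have := fin ((L ^ 2 + 1) / c) (by positivity)
  rw [mul_div_cancel₀ _ hcpos.ne'] at this
  linarith
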